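/- arXiv:1909.07743 — 3 statements merged into one kernel-verified Lean document; each statement's English description precedes it below -/
import Mathlib

section
/- Let 1 < q < p < ∞ and let μ be a finite measure on X = (0,1). If f and (f_n)_{n∈ℕ} are measurable functions on X with ‖f_n − f‖_{p,q),μ} → 0 as n → ∞, then f_n converges to f in μ-measure: for every δ > 0, μ{x ∈ X : |f_n(x) − f(x)| > δ} → 0 as n → ∞. -/
open MeasureTheory Set ENNReal Filter

/-- The unit interval `X = (0,1)` as a subtype of `ℝ`. -/
abbrev UnitIoo : Type := ↥(Set.Ioo (0 : ℝ) 1)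

/-- Decreasing rearrangement of a measurable function `f` on `X = (0,1)` with
respect to a measure `μ` on `X`:
`f*_μ(t) = inf { y > 0 : μ{x ∈ X : |f(x)| > y} ≤ t }`, with `inf ∅ = +∞`. -/
noncomputable def rearr (μ : Measure UnitIoo) (f : UnitIoo → ℝ) (t : ℝ) : ℝ≥0∞ :=
  sInf {y : ℝ≥0∞ | 0 < y ∧ μ {x | y < ENNReal.ofReal |f x|} ≤ ENNReal.ofReal t}

/-- The grand Lorentz functional
`‖f‖_{p,q),μ} = sup_{0<ε<q-1} ((q/p)·ε·∫₀¹ t^{q/p-1} (f*_μ(t))^{q-ε} dt)^{1/(q-ε)}`. -/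
noncomputable def grandLorentzNorm (μ : Measure UnitIoo) (p q : ℝ) (f : UnitIoo → ℝ) : ℝ≥0∞ :=
  ⨆ ε ∈ Set.Ioo (0 : ℝ) (q - 1),
    (ENNReal.ofReal (q / p * ε) *
        ∫⁻ t in Set.Ioo (0 : ℝ) 1,
          ENNReal.ofReal t ^ (q / p - 1) * rearr μ f t ^ (q - ε)) ^ (1 / (q - ε))

/-- If `|f|` exceeds `δ` on a set of measure greater than `a`, then `f*_μ ≥ δ` on `(0, a)`. -/
theorem le_rearr {μ : Measure UnitIoo} {f : UnitIoo → ℝ} {δ a t : ℝ} (hta : t ≤ a)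
    (h : ENNReal.ofReal a < μ {x | δ < |f x|}) : ENNReal.ofReal δ ≤ rearr μ f t := by
  refine le_sInf fun y hy => ?_
  by_contra! hlt
  refine absurd (hy.2.trans (ENNReal.ofReal_le_ofReal hta)) (not_le.2 (h.trans_le ?_))
  refine measure_mono fun x hx => ?_
  exact hlt.trans_le (ENNReal.ofReal_le_ofReal (le_of_lt hx))

/-- A lower bound for the grand Lorentz functional of a function exceeding `δ` in modulus on a
set of measure greater than `a`. -/
theorem le_grandLorentzNorm {μ : Measure UnitIoo} {p q ε δ a : ℝ} {f : UnitIoo → ℝ}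
    (hp : 0 < p) (hqp : q ≤ p) (hε : ε ∈ Set.Ioo 0 (q - 1)) (ha : a ≤ 1)
    (h : ENNReal.ofReal a < μ {x | δ < |f x|}) :
    (ENNReal.ofReal (q / p * ε) * (ENNReal.ofReal δ ^ (q - ε) * ENNReal.ofReal a)) ^
      (1 / (q - ε)) ≤ grandLorentzNorm μ p q f := by
  have hr : 0 ≤ q - ε := by linarith [hε.2]
  refine le_trans ?_ (le_iSup₂_of_le ε hε le_rfl)
  refine ENNReal.rpow_le_rpow (mul_le_mul_right ?_ _) (by positivity)
  calc ENNReal.ofReal δ ^ (q - ε) * ENNReal.ofReal a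
      = ∫⁻ _ in Set.Ioo (0 : ℝ) a, ENNReal.ofReal δ ^ (q - ε) := by simp
    _ ≤ ∫⁻ t in Set.Ioo (0 : ℝ) a,
          ENNReal.ofReal t ^ (q / p - 1) * rearr μ f t ^ (q - ε) := by
        refine setLIntegral_mono' measurableSet_Ioo fun t ht => ?_
        rw [← one_mul (ENNReal.ofReal δ ^ (q - ε))]
        refine mul_le_mul' ?_ (ENNReal.rpow_le_rpow (le_rearr ht.2.le h) hr)
        rw [← neg_sub, ENNReal.rpow_neg, ENNReal.one_le_inv]
        refine ENNReal.rpow_le_one ?_ (sub_nonneg.2 ((div_le_one hp).2 hqp))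
        exact ENNReal.ofReal_le_one.2 (ht.2.le.trans ha)
    _ ≤ _ := lintegral_mono_set (Set.Ioo_subset_Ioo_right ha)

/-- If `1 < q < p < ∞`, `μ` is a finite measure on `X = (0,1)` and
`‖F n − f‖_{p,q),μ} → 0`, then `F n → f` in `μ`-measure. -/
theorem stmt0 (p q : ℝ) (hq : 1 < q) (hqp : q < p)
    (μ : Measure UnitIoo) [IsFiniteMeasure μ]
    (f : UnitIoo → ℝ) (F : ℕ → UnitIoo → ℝ)
    (hf : Measurable f) (hF : ∀ n, Measurable (F n))
    (hconv : Tendsto (fun n => grandLorentzNorm μ p q (fun x => F n x - f x))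
      atTop (nhds 0)) :
    ∀ δ : ℝ, 0 < δ →
      Tendsto (fun n => μ {x | δ < |F n x - f x|}) atTop (nhds 0) := by
  intro δ hδ
  have hp : 0 < p := by linarith
  have hε : (q - 1) / 2 ∈ Set.Ioo 0 (q - 1) := ⟨by linarith, by linarith⟩
  rw [ENNReal.tendsto_nhds_zero]
  intro η hη
  have hη1 : min η 1 ≠ ∞ := ne_top_of_le_ne_top one_ne_top (min_le_right _ _)
  have ha : ENNReal.ofReal (min η 1).toReal = min η 1 := ENNReal.ofReal_toReal hη1
  have hapos : 0 < ENNReal.ofReal (min η 1).toReal := by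
    rw [ha]
    exact lt_min hη one_pos
  have ha1 : (min η 1).toReal ≤ 1 := ENNReal.toReal_le_of_le_ofReal zero_le_one (by simp)
  have hc : 0 < ENNReal.ofReal (q / p * ((q - 1) / 2)) :=
    ENNReal.ofReal_pos.2 (mul_pos (div_pos (by linarith) hp) hε.1)
  have hd : 0 < ENNReal.ofReal δ ^ (q - (q - 1) / 2) :=
    ENNReal.rpow_pos (ENNReal.ofReal_pos.2 hδ) ENNReal.ofReal_ne_top
  have hK : 0 < (ENNReal.ofReal (q / p * ((q - 1) / 2)) * (ENNReal.ofReal δ ^ (q - (q - 1) / 2) *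
      ENNReal.ofReal (min η 1).toReal)) ^ (1 / (q - (q - 1) / 2)) := by
    refine ENNReal.rpow_pos (ENNReal.mul_pos hc.ne' (ENNReal.mul_pos hd.ne' hapos.ne').ne') ?_
    refine ENNReal.mul_ne_top ENNReal.ofReal_ne_top (ENNReal.mul_ne_top ?_ ENNReal.ofReal_ne_top)
    exact ENNReal.rpow_ne_top_of_nonneg (by linarith [hε.2]) ENNReal.ofReal_ne_top
  filter_upwards [hconv.eventually_lt_const hK] with n hn
  by_contra! hlt
  refine absurd hn (not_lt.2 (le_grandLorentzNorm hp hqp.le hε ha1 ?_))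
  rw [ha]
  exact (min_le_left _ _).trans_lt hlt
end

section
/- Let 1 < q < p < ∞ and 1 < s < r < ∞, let μ and ν be finite measures on (X,Σ) with X = (0,1) and μ ≈ ν, and suppose L^{p,q)}(X,μ) ⊆ L^{r,s)}(X,ν) holds in the sense of individual functions. Then L^{p,q)}(X,μ), identified modulo μ-almost-everywhere equality and endowed with the sum norm ‖f‖ = ‖f‖_{p,q),μ} + ‖f‖_{r,s),ν}, is a complete normed space. -/
open MeasureTheory Set ENNReal Filter

/-- The sum functional `‖f‖ = ‖f‖_{p,q),μ} + ‖f‖_{r,s),ν}`. -/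
noncomputable def sumNorm (μ ν : Measure UnitIoo) (p q r s : ℝ) (f : UnitIoo → ℝ) : ℝ≥0∞ :=
  grandLorentzNorm μ p q f + grandLorentzNorm ν r s f

section Rearrangement

variable {μ : Measure UnitIoo} {f g : UnitIoo → ℝ} {t : ℝ} {y : ℝ≥0∞}

lemma rearr_le_iff : rearr μ f t ≤ y ↔ μ {x | y < ENNReal.ofReal |f x|} ≤ ENNReal.ofReal t := by
  constructor
  · intro h
    rcases eq_or_ne y ⊤ with rfl | hy
    · simp
    obtain ⟨u, hu, huy, hlim⟩ := exists_seq_strictAnti_tendsto' hy.lt_top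
    have hset : {x | y < ENNReal.ofReal |f x|} = ⋃ n, {x | u n < ENNReal.ofReal |f x|} := by
      ext x
      simp only [mem_ofPred_eq, mem_iUnion]
      exact ⟨fun hx => (hlim.eventually_lt_const hx).exists,
        fun ⟨n, hn⟩ => (huy n).1.trans hn⟩
    have hmono : Monotone fun n => {x | u n < ENNReal.ofReal |f x|} :=
      fun m n hmn x hx => (hu.antitone hmn).trans_lt hx
    rw [hset, hmono.measure_iUnion]
    refine iSup_le fun n => ?_
    obtain ⟨z, ⟨-, hz⟩, hzu⟩ := sInf_lt_iff.1 (h.trans_lt (huy n).1)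
    exact (measure_mono fun x hx => hzu.trans hx).trans hz
  · intro h
    refine le_of_forall_gt fun z hz => ?_
    obtain ⟨w, hyw, hwz⟩ := exists_between hz
    have hw : w ∈ {y : ℝ≥0∞ | 0 < y ∧ μ {x | y < ENNReal.ofReal |f x|} ≤ ENNReal.ofReal t} :=
      ⟨zero_le.trans_lt hyw, (measure_mono fun x hx => hyw.trans hx).trans h⟩
    exact (sInf_le hw).trans_lt hwz

lemma lt_rearr_iff : y < rearr μ f t ↔ ENNReal.ofReal t < μ {x | y < ENNReal.ofReal |f x|} := by
  rw [← not_le, rearr_le_iff, not_le]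

lemma rearr_antitone (μ : Measure UnitIoo) (f : UnitIoo → ℝ) : Antitone (rearr μ f) :=
  fun _ _ hst => rearr_le_iff.2 ((rearr_le_iff.1 le_rfl).trans (ENNReal.ofReal_le_ofReal hst))

lemma measurable_rearr (μ : Measure UnitIoo) (f : UnitIoo → ℝ) : Measurable (rearr μ f) :=
  (rearr_antitone μ f).measurable

lemma rearr_const_smul (c : ℝ) : rearr μ (c • f) t = ENNReal.ofReal |c| * rearr μ f t := by
  refine eq_of_forall_ge_iff fun y => ?_
  rcases eq_or_ne c 0 with rfl | hc
  · simp [rearr_le_iff]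
  have hc0 : ENNReal.ofReal |c| ≠ 0 := by simpa using hc
  rw [mul_comm, ← ENNReal.le_div_iff_mul_le (Or.inl hc0) (Or.inl ofReal_ne_top), rearr_le_iff,
    rearr_le_iff]
  simp only [ENNReal.div_lt_iff (Or.inl hc0) (Or.inl ofReal_ne_top), Pi.smul_apply, smul_eq_mul,
    abs_mul, ENNReal.ofReal_mul (abs_nonneg c), mul_comm]

lemma rearr_le_liminf {F : ℕ → UnitIoo → ℝ}
    (h : ∀ᵐ x ∂μ, Tendsto (fun n => F n x) atTop (nhds (f x))) :
    rearr μ f t ≤ liminf (fun n => rearr μ (F n) t) atTop := by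
  refine le_of_forall_lt fun y hy => ?_
  obtain ⟨z, hyz, hz⟩ := exists_between hy
  refine hyz.trans_le (le_liminf_of_le (by isBoundedDefault) ?_)
  rw [lt_rearr_iff] at hz
  have hmono : Monotone fun k => {x | ∀ n ≥ k, z < ENNReal.ofReal |F n x|} :=
    fun k l hkl x hx n hn => hx n (hkl.trans hn)
  have hsub : μ {x | z < ENNReal.ofReal |f x|} ≤
      μ (⋃ k, {x | ∀ n ≥ k, z < ENNReal.ofReal |F n x|}) := by
    refine measure_mono_ae ?_
    filter_upwards [h] with x hx hzx
    have hlim : Tendsto (fun n => ENNReal.ofReal |F n x|) atTop (nhds (ENNReal.ofReal |f x|)) :=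
      ENNReal.tendsto_ofReal hx.abs
    obtain ⟨k, hk⟩ := eventually_atTop.1 (hlim.eventually_const_lt hzx)
    exact mem_iUnion.2 ⟨k, hk⟩
  rw [hmono.measure_iUnion] at hsub
  obtain ⟨k, hk⟩ := lt_iSup_iff.1 (hz.trans_le hsub)
  filter_upwards [eventually_ge_atTop k] with n hn
  exact (lt_rearr_iff.2 (hk.trans_le (measure_mono fun x hx => hx n hn))).le

end Rearrangement

section LayerCake

lemma volume_Ioi_inter_ofReal_lt (m : ℝ≥0∞) :
    volume {y : ℝ | 0 < y ∧ ENNReal.ofReal y < m} = m := by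
  rcases eq_or_ne m ⊤ with rfl | hm
  · have : {y : ℝ | 0 < y ∧ ENNReal.ofReal y < ⊤} = Ioi 0 := by ext; simp
    rw [this, Real.volume_Ioi]
  · have : {y : ℝ | 0 < y ∧ ENNReal.ofReal y < m} = Ioo 0 m.toReal := by
      ext y
      simp only [mem_ofPred_eq, mem_Ioo, and_congr_right_iff]
      exact fun hy => ENNReal.ofReal_lt_iff_lt_toReal hy.le hm
    rw [this, Real.volume_Ioo, sub_zero, ENNReal.ofReal_toReal hm]

lemma lintegral_eq_lintegral_Ioi_meas_lt {α : Type*} [MeasurableSpace α] (μ : Measure α)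
    [SFinite μ] {φ : α → ℝ≥0∞} (hφ : Measurable φ) :
    ∫⁻ x, φ x ∂μ = ∫⁻ y in Ioi (0 : ℝ), μ {x | ENNReal.ofReal y < φ x} := by
  have hmeas : MeasurableSet {z : α × ℝ | ENNReal.ofReal z.2 < φ z.1} :=
    measurableSet_lt (ENNReal.measurable_ofReal.comp measurable_snd) (hφ.comp measurable_fst)
  have hswap := lintegral_lintegral_swap (μ := μ) (ν := volume.restrict (Ioi (0 : ℝ)))
    (f := fun x y => indicator {z : α × ℝ | ENNReal.ofReal z.2 < φ z.1} 1 (x, y))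
    (measurable_one.indicator hmeas).aemeasurable
  have hleft (x : α) : ∫⁻ y in Ioi (0 : ℝ),
      indicator {z : α × ℝ | ENNReal.ofReal z.2 < φ z.1} 1 (x, y) = φ x := by
    have hs : MeasurableSet {y : ℝ | ENNReal.ofReal y < φ x} :=
      measurableSet_lt ENNReal.measurable_ofReal measurable_const
    calc _ = ∫⁻ y in Ioi (0 : ℝ), indicator {y : ℝ | ENNReal.ofReal y < φ x} 1 y := rfl
      _ = _ := by
        rw [lintegral_indicator_one hs, Measure.restrict_apply hs, inter_comm]
        exact volume_Ioi_inter_ofReal_lt (φ x)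
  have hright (y : ℝ) : ∫⁻ x, indicator {z : α × ℝ | ENNReal.ofReal z.2 < φ z.1} 1 (x, y) ∂μ =
      μ {x | ENNReal.ofReal y < φ x} :=
    lintegral_indicator_one (s := {x | ENNReal.ofReal y < φ x})
      (measurableSet_lt measurable_const hφ)
  simpa only [hleft, hright] using hswap

variable {μ : Measure UnitIoo} [IsFiniteMeasure μ] {f g : UnitIoo → ℝ}

lemma lintegral_rearr_sub (hf : Measurable f) (c : ℝ≥0∞) :
    ∫⁻ t in Ioi (0 : ℝ), (rearr μ f t - c) = ∫⁻ x, (ENNReal.ofReal |f x| - c) ∂μ := by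
  rw [lintegral_eq_lintegral_Ioi_meas_lt _ ((measurable_rearr μ f).sub_const c),
    lintegral_eq_lintegral_Ioi_meas_lt μ (hf.abs.ennreal_ofReal.sub_const c)]
  refine lintegral_congr fun y => ?_
  have hs : MeasurableSet {t | ENNReal.ofReal y < rearr μ f t - c} :=
    measurableSet_lt measurable_const ((measurable_rearr μ f).sub_const c)
  rw [Measure.restrict_apply hs, inter_comm]
  simp only [lt_tsub_iff_left, lt_rearr_iff]
  exact volume_Ioi_inter_ofReal_lt _

lemma lintegral_Ioo_rearr_le (hf : Measurable f) (c : ℝ≥0∞) (t : ℝ) :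
    ∫⁻ u in Ioo 0 t, rearr μ f u ≤
      c * ENNReal.ofReal t + ∫⁻ x, (ENNReal.ofReal |f x| - c) ∂μ := by
  calc ∫⁻ u in Ioo 0 t, rearr μ f u ≤ ∫⁻ u in Ioo 0 t, (c + (rearr μ f u - c)) :=
        lintegral_mono fun u => le_add_tsub
    _ = c * ENNReal.ofReal t + ∫⁻ u in Ioo 0 t, (rearr μ f u - c) := by
        rw [lintegral_add_left measurable_const]; simp
    _ ≤ _ := by
        rw [← lintegral_rearr_sub hf]
        gcongr
        exact Ioo_subset_Ioi_self

lemma le_lintegral_Ioo_rearr (hf : Measurable f) (t : ℝ) :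
    rearr μ f t * ENNReal.ofReal t + ∫⁻ x, (ENNReal.ofReal |f x| - rearr μ f t) ∂μ ≤
      ∫⁻ u in Ioo 0 t, rearr μ f u := by
  have hsupp : ∫⁻ u in Ioi (0 : ℝ), (rearr μ f u - rearr μ f t) =
      ∫⁻ u in Ioo 0 t, (rearr μ f u - rearr μ f t) := by
    have hsub : (Function.support fun u => rearr μ f u - rearr μ f t) ⊆ Iio t := fun u hu =>
      not_le.1 fun htu => hu (tsub_eq_zero_of_le (rearr_antitone μ f htu))
    rw [← setLIntegral_eq_of_support_subset hsub, Measure.restrict_restrict measurableSet_Iio,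
      inter_comm, Ioi_inter_Iio]
  calc _ = ∫⁻ u in Ioo 0 t, (rearr μ f t + (rearr μ f u - rearr μ f t)) := by
        rw [lintegral_add_left measurable_const, ← lintegral_rearr_sub hf, hsupp]; simp
    _ ≤ _ := setLIntegral_mono (measurable_rearr μ f) fun u hu =>
        (add_tsub_cancel_of_le (rearr_antitone μ f hu.2.le)).le

lemma lintegral_Ioo_rearr_add_le (hf : Measurable f) (hg : Measurable g) (t : ℝ) :
    ∫⁻ u in Ioo 0 t, rearr μ (f + g) u ≤ ∫⁻ u in Ioo 0 t, (rearr μ f u + rearr μ g u) := by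
  set c := rearr μ f t
  set d := rearr μ g t
  have hpt (x : UnitIoo) : ENNReal.ofReal |(f + g) x| - (c + d) ≤
      (ENNReal.ofReal |f x| - c) + (ENNReal.ofReal |g x| - d) := by
    refine le_trans (tsub_le_tsub_right ?_ _) add_tsub_add_le_tsub_add_tsub
    rw [← ENNReal.ofReal_add (abs_nonneg _) (abs_nonneg _)]
    exact ENNReal.ofReal_le_ofReal (abs_add_le _ _)
  calc _ ≤ (c + d) * ENNReal.ofReal t + ∫⁻ x, (ENNReal.ofReal |(f + g) x| - (c + d)) ∂μ :=
        lintegral_Ioo_rearr_le (hf.add hg) _ _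
    _ ≤ (c + d) * ENNReal.ofReal t +
        ∫⁻ x, ((ENNReal.ofReal |f x| - c) + (ENNReal.ofReal |g x| - d)) ∂μ := by
        gcongr with x; exact hpt x
    _ = (c * ENNReal.ofReal t + ∫⁻ x, (ENNReal.ofReal |f x| - c) ∂μ) +
        (d * ENNReal.ofReal t + ∫⁻ x, (ENNReal.ofReal |g x| - d) ∂μ) := by
        rw [lintegral_add_left (hf.abs.ennreal_ofReal.sub_const c)]
        ring
    _ ≤ _ := by
        rw [lintegral_add_left (measurable_rearr μ f)]
        exact add_le_add (le_lintegral_Ioo_rearr hf t) (le_lintegral_Ioo_rearr hg t)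

end LayerCake

section Hardy

lemma exists_ae_eq_Ioo_of_lt_antitone {k : ℝ → ℝ≥0∞} (hk : Antitone k) (y : ℝ≥0∞) :
    ∃ c : ℝ, ({t | y < k t} ∩ Ioo 0 1 : Set ℝ) =ᵐ[volume] Ioo 0 c := by
  set S : Set ℝ := {t | y < k t} ∩ Ioo 0 1
  have hbdd : BddAbove S := ⟨1, fun t ht => ht.2.2.le⟩
  rcases S.eq_empty_or_nonempty with hS | hS
  · exact ⟨0, by simp [hS]⟩
  refine ⟨sSup S, ?_⟩
  have h1 : Ioo 0 (sSup S) ⊆ S := by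
    intro t ht
    obtain ⟨u, hu, htu⟩ := exists_lt_of_lt_csSup hS ht.2
    exact ⟨lt_of_lt_of_le (show y < k u from hu.1) (hk htu.le), ht.1, htu.trans hu.2.2⟩
  have h2 : S ⊆ Ioc 0 (sSup S) := fun t ht => ⟨ht.2.1, le_csSup hbdd ht⟩
  exact (h2.eventuallyLE.trans Ioo_ae_eq_Ioc.symm.le).antisymm h1.eventuallyLE

/-- Hardy's lemma: domination of integrals over initial segments is preserved by antitone
weights. -/
lemma lintegral_mul_le_of_antitone {H K k : ℝ → ℝ≥0∞} (hH : Measurable H) (hK : Measurable K)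
    (hk : Antitone k) (hHK : ∀ t, ∫⁻ u in Ioo 0 t, H u ≤ ∫⁻ u in Ioo 0 t, K u) :
    ∫⁻ t in Ioo (0 : ℝ) 1, H t * k t ≤ ∫⁻ t in Ioo (0 : ℝ) 1, K t * k t := by
  have hkm := hk.measurable
  have hS (y : ℝ≥0∞) : MeasurableSet {t | y < k t} := measurableSet_lt measurable_const hkm
  have key {G : ℝ → ℝ≥0∞} (hG : Measurable G) : ∫⁻ t in Ioo (0 : ℝ) 1, G t * k t =
      ∫⁻ y in Ioi (0 : ℝ), ∫⁻ t in {t | ENNReal.ofReal y < k t} ∩ Ioo 0 1, G t := by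
    have := lintegral_withDensity_eq_lintegral_mul (volume.restrict (Ioo (0 : ℝ) 1)) hG hkm
    simp only [Pi.mul_apply] at this
    rw [← this, lintegral_eq_lintegral_Ioi_meas_lt _ hkm]
    refine lintegral_congr fun y => ?_
    rw [withDensity_apply _ (hS _), Measure.restrict_restrict (hS _)]
  rw [key hH, key hK]
  refine lintegral_mono fun y => ?_
  obtain ⟨c, hc⟩ := exists_ae_eq_Ioo_of_lt_antitone hk (ENNReal.ofReal y)
  dsimp only
  rw [setLIntegral_congr hc, setLIntegral_congr hc]
  exact hHK c

lemma lintegral_rpow_le_of_lintegral_mul_rpow_le {α : Type*} [MeasurableSpace α] {μ : Measure α}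
    {a : ℝ} (ha : 1 < a) {F G h : α → ℝ≥0∞} (hF : Measurable F) (hG : Measurable G)
    (hh : Measurable h) (hfin : ∫⁻ x, h x ^ a ∂μ ≠ ⊤)
    (hle : ∫⁻ x, h x ^ a ∂μ ≤ ∫⁻ x, (F x + G x) * h x ^ (a - 1) ∂μ) :
    (∫⁻ x, h x ^ a ∂μ) ^ (1 / a) ≤
      (∫⁻ x, F x ^ a ∂μ) ^ (1 / a) + (∫⁻ x, G x ^ a ∂μ) ^ (1 / a) := by
  have ha0 : 0 < a := by linarith
  have hconj := Real.HolderConjugate.conjExponent ha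
  set b := a.conjExponent
  set I := ∫⁻ x, h x ^ a ∂μ
  rcases eq_or_ne I 0 with hI | hI
  · simp [hI, ha0]
  have hb : 0 < 1 / b := one_div_pos.2 hconj.symm.pos
  have hIb : I ^ (1 / b) ≠ 0 := by simp [ENNReal.rpow_eq_zero_iff, hI, hfin]
  have hIb' : I ^ (1 / b) ≠ ⊤ := ENNReal.rpow_ne_top_of_nonneg hb.le hfin
  have hsum : 1 / a + 1 / b = 1 := by simpa using hconj.inv_add_inv_eq_one
  refine (ENNReal.mul_le_mul_iff_left hIb hIb').1 ?_
  calc I ^ (1 / a) * I ^ (1 / b) = I := by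
        rw [← ENNReal.rpow_add _ _ hI hfin, hsum, ENNReal.rpow_one]
    _ ≤ _ := hle
    _ = ∫⁻ x, F x * h x ^ (a - 1) ∂μ + ∫⁻ x, G x * h x ^ (a - 1) ∂μ := by
        simp_rw [add_mul]
        exact lintegral_add_left (hF.mul (hh.pow_const _)) _
    _ ≤ _ := by
        rw [add_mul]
        exact add_le_add
          (ENNReal.lintegral_mul_rpow_le_lintegral_rpow_mul_lintegral_rpow hconj hF.aemeasurable
            hh.aemeasurable)
          (ENNReal.lintegral_mul_rpow_le_lintegral_rpow_mul_lintegral_rpow hconj hG.aemeasurable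
            hh.aemeasurable)

/-- Minkowski's inequality for weighted integrals with an antitone weight, where `H ≤ F + G` is
only assumed for the integrals over initial segments. -/
lemma lintegral_mul_rpow_le_add_of_antitone {a : ℝ} (ha : 1 < a) {w F G H : ℝ → ℝ≥0∞}
    (hw : Antitone w) (hwfin : ∫⁻ t in Ioo (0 : ℝ) 1, w t ≠ ⊤) (hF : Measurable F)
    (hG : Measurable G) (hH : Antitone H)
    (hle : ∀ t, ∫⁻ u in Ioo 0 t, H u ≤ ∫⁻ u in Ioo 0 t, (F u + G u)) :
    (∫⁻ t in Ioo (0 : ℝ) 1, w t * H t ^ a) ^ (1 / a) ≤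
      (∫⁻ t in Ioo (0 : ℝ) 1, w t * F t ^ a) ^ (1 / a) +
        (∫⁻ t in Ioo (0 : ℝ) 1, w t * G t ^ a) ^ (1 / a) := by
  have ha0 : 0 < a := by linarith
  have hw_meas := hw.measurable
  set wm := (volume.restrict (Ioo (0 : ℝ) 1)).withDensity w with hwm
  have key {φ : ℝ → ℝ≥0∞} (hφ : Measurable φ) :
      ∫⁻ t in Ioo (0 : ℝ) 1, w t * φ t = ∫⁻ t, φ t ∂wm :=
    (lintegral_withDensity_eq_lintegral_mul _ hw_meas hφ).symm
  rw [key (hH.measurable.pow_const a), key (hF.pow_const a), key (hG.pow_const a)]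
  set B := (∫⁻ t, F t ^ a ∂wm) ^ (1 / a) + (∫⁻ t, G t ^ a ∂wm) ^ (1 / a)
  have htrunc (N : ℕ) : ∫⁻ t, min (H t) N ^ a ∂wm ≤ B ^ a := by
    have hh : Antitone fun t => min (H t) (N : ℝ≥0∞) := fun u v huv => min_le_min_right _ (hH huv)
    rw [← ENNReal.rpow_inv_le_iff ha0, ← one_div]
    refine lintegral_rpow_le_of_lintegral_mul_rpow_le ha hF hG hh.measurable ?_ ?_
    · refine ne_top_of_le_ne_top
        (ENNReal.mul_ne_top (ENNReal.rpow_ne_top_of_nonneg ha0.le (natCast_ne_top N)) hwfin) ?_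
      calc _ ≤ ∫⁻ _, (N : ℝ≥0∞) ^ a ∂wm := by
            gcongr; exact min_le_right _ _
        _ = _ := by simp [hwm, withDensity_apply]
    · have hk : Antitone fun t => w t * min (H t) (N : ℝ≥0∞) ^ (a - 1) := fun u v huv =>
        mul_le_mul' (hw huv) (ENNReal.rpow_le_rpow (hh huv) (by linarith))
      calc ∫⁻ t, min (H t) N ^ a ∂wm ≤ ∫⁻ t, H t * min (H t) N ^ (a - 1) ∂wm := by
            refine lintegral_mono fun t => ?_
            calc min (H t) (N : ℝ≥0∞) ^ a = min (H t) (N : ℝ≥0∞) ^ (1 + (a - 1)) := by ring_nf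
              _ = min (H t) (N : ℝ≥0∞) * min (H t) (N : ℝ≥0∞) ^ (a - 1) := by
                rw [ENNReal.rpow_add_of_nonneg _ _ zero_le_one (by linarith), ENNReal.rpow_one]
              _ ≤ _ := by gcongr; exact min_le_left _ _
        _ = ∫⁻ t in Ioo (0 : ℝ) 1, H t * (w t * min (H t) N ^ (a - 1)) := by
            have := key (φ := fun t => H t * min (H t) (N : ℝ≥0∞) ^ (a - 1))
              (hH.measurable.mul (hh.measurable.pow_const _))
            simp only [← this, mul_left_comm]
        _ ≤ ∫⁻ t in Ioo (0 : ℝ) 1, (F t + G t) * (w t * min (H t) N ^ (a - 1)) :=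
            lintegral_mul_le_of_antitone hH.measurable (hF.add hG) hk hle
        _ = _ := by
            have := key (φ := fun t => (F t + G t) * min (H t) (N : ℝ≥0∞) ^ (a - 1))
              ((hF.add hG).mul (hh.measurable.pow_const _))
            simp only [← this, mul_left_comm]
  rw [one_div, ENNReal.rpow_inv_le_iff ha0]
  have hsup (t : ℝ) : H t ^ a = ⨆ N : ℕ, min (H t) (N : ℝ≥0∞) ^ a := by
    refine le_antisymm ?_ (iSup_le fun N => ENNReal.rpow_le_rpow (min_le_left _ _) ha0.le)
    have hlim : Tendsto (fun N : ℕ => min (H t) (N : ℝ≥0∞) ^ a) atTop (nhds (H t ^ a)) := by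
      have h1 : Tendsto (fun N : ℕ => min (H t) (N : ℝ≥0∞)) atTop (nhds (min (H t) ⊤)) :=
        tendsto_const_nhds.min ENNReal.tendsto_nat_nhds_top
      rw [min_top_right] at h1
      exact (ENNReal.continuous_rpow_const.tendsto _).comp h1
    exact le_of_tendsto' hlim fun N => le_iSup (fun N : ℕ => min (H t) (N : ℝ≥0∞) ^ a) N
  simp_rw [hsup]
  rw [lintegral_iSup]
  · exact iSup_le htrunc
  · exact fun N => (hH.measurable.min measurable_const).pow_const _
  · exact fun M N hMN t =>
      ENNReal.rpow_le_rpow (min_le_min_left _ (Nat.cast_le.2 hMN)) ha0.le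

end Hardy

section PowerWeight

variable {b : ℝ}

lemma antitone_ofReal_rpow (hb : b ≤ 0) : Antitone fun t : ℝ => ENNReal.ofReal t ^ b := by
  intro u v huv
  have := ENNReal.rpow_le_rpow (ENNReal.ofReal_le_ofReal huv) (neg_nonneg.2 hb)
  rwa [ENNReal.rpow_neg, ENNReal.rpow_neg, ENNReal.inv_le_inv] at this

lemma lintegral_Ioo_ofReal_rpow_ne_top (hb : -1 < b) :
    ∫⁻ t in Ioo (0 : ℝ) 1, ENNReal.ofReal t ^ b ≠ ⊤ := by
  have h := ((intervalIntegral.integrableOn_Ioo_rpow_iff one_pos).2 hb).lintegral_lt_top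
  rw [setLIntegral_congr_fun measurableSet_Ioo
    fun t (ht : t ∈ Ioo (0 : ℝ) 1) => ENNReal.ofReal_rpow_of_pos ht.1]
  exact h.ne

end PowerWeight

section GrandLorentz

variable {μ : Measure UnitIoo} {p q : ℝ} {f g : UnitIoo → ℝ}

lemma grandLorentzNorm_add_le [IsFiniteMeasure μ] (hq : 1 < q) (hqp : q < p) (hf : Measurable f)
    (hg : Measurable g) :
    grandLorentzNorm μ p q (f + g) ≤ grandLorentzNorm μ p q f + grandLorentzNorm μ p q g := by
  have hp : 0 < p := by linarith
  have hb : q / p - 1 ≤ 0 := by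
    rw [sub_nonpos, div_le_one hp]; exact hqp.le
  have hb' : -1 < q / p - 1 := by
    have : 0 < q / p := by positivity
    linarith
  refine iSup₂_le fun ε hε => ?_
  have ha : 1 < q - ε := by linarith [hε.2]
  have ha' : 0 ≤ 1 / (q - ε) := by positivity
  refine le_trans ?_ (add_le_add (le_iSup₂ ε hε) (le_iSup₂ ε hε))
  simp only [ENNReal.mul_rpow_of_nonneg _ _ ha']
  rw [← mul_add]
  gcongr
  exact lintegral_mul_rpow_le_add_of_antitone ha (antitone_ofReal_rpow hb)
    (lintegral_Ioo_ofReal_rpow_ne_top hb') (measurable_rearr μ f) (measurable_rearr μ g)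
    (rearr_antitone μ _) (lintegral_Ioo_rearr_add_le hf hg)

lemma grandLorentzNorm_const_smul (c : ℝ) :
    grandLorentzNorm μ p q (c • f) = ENNReal.ofReal |c| * grandLorentzNorm μ p q f := by
  simp only [grandLorentzNorm, ENNReal.mul_iSup]
  refine iSup_congr fun ε => iSup_congr fun hε => ?_
  have ha : 0 < q - ε := by linarith [hε.2]
  have ha' : 0 ≤ 1 / (q - ε) := by positivity
  have hc : ENNReal.ofReal |c| ^ (q - ε) ≠ ⊤ := ENNReal.rpow_ne_top_of_nonneg ha.le ofReal_ne_top
  simp only [rearr_const_smul, ENNReal.mul_rpow_of_nonneg _ _ ha.le]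
  simp only [mul_left_comm _ (ENNReal.ofReal |c| ^ (q - ε))]
  rw [lintegral_const_mul' _ _ hc, mul_left_comm, ENNReal.mul_rpow_of_nonneg _ _ ha',
    ← ENNReal.rpow_mul, mul_one_div_cancel ha.ne', ENNReal.rpow_one]

lemma exists_mul_rearr_le_grandLorentzNorm (hq : 1 < q) (hqp : q < p) {t : ℝ}
    (ht : t ∈ Ioo (0 : ℝ) 1) :
    ∃ C : ℝ≥0∞, C ≠ 0 ∧ C ≠ ⊤ ∧
      ∀ (μ : Measure UnitIoo) f, C * rearr μ f t ≤ grandLorentzNorm μ p q f := by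
  have hp : 0 < p := by linarith
  have hb : q / p - 1 ≤ 0 := by
    rw [sub_nonpos, div_le_one hp]; exact hqp.le
  set ε := (q - 1) / 2 with hε_def
  have hε : ε ∈ Ioo 0 (q - 1) := ⟨by linarith, by linarith⟩
  have ha : 0 < q - ε := by linarith [hε.2]
  have ha' : 0 < 1 / (q - ε) := by positivity
  have hκ : 0 < q / p * ε := mul_pos (by positivity) hε.1
  refine ⟨(ENNReal.ofReal (q / p * ε) * ENNReal.ofReal t) ^ (1 / (q - ε)), ?_, ?_, fun μ f => ?_⟩
  · simp [ENNReal.rpow_eq_zero_iff, ha, ha.not_gt, hκ, ht.1, ENNReal.mul_eq_top]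
  · exact ENNReal.rpow_ne_top_of_nonneg ha'.le (ENNReal.mul_ne_top ofReal_ne_top ofReal_ne_top)
  refine le_trans ?_ (le_iSup₂ ε hε)
  have hr : rearr μ f t = (rearr μ f t ^ (q - ε)) ^ (1 / (q - ε)) := by
    rw [← ENNReal.rpow_mul, mul_one_div_cancel ha.ne', ENNReal.rpow_one]
  rw [hr, ← ENNReal.mul_rpow_of_nonneg _ _ ha'.le, mul_assoc]
  gcongr
  calc ENNReal.ofReal t * rearr μ f t ^ (q - ε) = ∫⁻ _ in Ioo 0 t, rearr μ f t ^ (q - ε) := by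
        simp [mul_comm]
    _ ≤ ∫⁻ u in Ioo 0 t, ENNReal.ofReal u ^ (q / p - 1) * rearr μ f u ^ (q - ε) := by
        refine setLIntegral_mono' measurableSet_Ioo fun u hu => ?_
        have h1 : 1 ≤ ENNReal.ofReal u ^ (q / p - 1) := by
          simpa using antitone_ofReal_rpow hb (hu.2.trans ht.2).le
        exact (one_mul _).symm.le.trans (mul_le_mul' h1
          (ENNReal.rpow_le_rpow (rearr_antitone μ f hu.2.le) ha.le))
    _ ≤ _ := lintegral_mono_set (Ioo_subset_Ioo_right ht.2.le)

lemma ae_eq_zero_of_grandLorentzNorm_eq_zero (hq : 1 < q) (hqp : q < p)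
    (h : grandLorentzNorm μ p q f = 0) : f =ᵐ[μ] 0 := by
  have hle : ∀ t ∈ Ioo (0 : ℝ) 1, μ {x | 0 < ENNReal.ofReal |f x|} ≤ ENNReal.ofReal t := by
    intro t ht
    obtain ⟨C, hC0, -, hC⟩ := exists_mul_rearr_le_grandLorentzNorm hq hqp ht
    have h0 := hC μ f
    rw [h, nonpos_iff_eq_zero, mul_eq_zero, or_iff_right hC0] at h0
    exact rearr_le_iff.1 h0.le
  have hlim : Tendsto (fun t : ℝ => ENNReal.ofReal t) (nhdsWithin 0 (Ioi 0)) (nhds 0) := by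
    simpa using (ENNReal.continuous_ofReal.tendsto 0).mono_left nhdsWithin_le_nhds
  have hzero : μ {x | 0 < ENNReal.ofReal |f x|} ≤ 0 :=
    ge_of_tendsto hlim (by filter_upwards [Ioo_mem_nhdsGT one_pos] with t ht using hle t ht)
  refine measure_mono_null (fun x hx => ?_) (nonpos_iff_eq_zero.1 hzero)
  simpa using hx

/-- The Fatou property of the grand Lorentz functional. -/
lemma grandLorentzNorm_le_of_tendsto_ae {F : ℕ → UnitIoo → ℝ} {δ : ℝ≥0∞}
    (h : ∀ᵐ x ∂μ, Tendsto (fun n => F n x) atTop (nhds (f x)))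
    (hδ : ∀ᶠ n in atTop, grandLorentzNorm μ p q (F n) ≤ δ) :
    grandLorentzNorm μ p q f ≤ δ := by
  refine iSup₂_le fun ε hε => ?_
  have ha : 0 < q - ε := by linarith [hε.2]
  rw [one_div, ENNReal.rpow_inv_le_iff ha]
  set κ := ENNReal.ofReal (q / p * ε)
  set Φ : ℝ → ℝ≥0∞ → ℝ≥0∞ := fun t x => κ * (ENNReal.ofReal t ^ (q / p - 1) * x ^ (q - ε))
    with hΦ
  have hΦmono (t : ℝ) : Monotone (Φ t) := fun x y hxy => by
    simp only [hΦ]; gcongr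
  have hΦcont {t : ℝ} (ht : 0 < t) : Continuous (Φ t) := by
    have hw : ENNReal.ofReal t ^ (q / p - 1) ≠ ⊤ := by
      rw [ENNReal.ofReal_rpow_of_pos ht]; exact ofReal_ne_top
    exact (ENNReal.continuous_const_mul ofReal_ne_top).comp
      ((ENNReal.continuous_const_mul hw).comp ENNReal.continuous_rpow_const)
  have hint (φ : UnitIoo → ℝ) : κ * ∫⁻ t in Ioo (0 : ℝ) 1,
      ENNReal.ofReal t ^ (q / p - 1) * rearr μ φ t ^ (q - ε) =
      ∫⁻ t in Ioo (0 : ℝ) 1, Φ t (rearr μ φ t) :=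
    (lintegral_const_mul' _ _ ofReal_ne_top).symm
  have hmeas (n : ℕ) : Measurable fun t => Φ t (rearr μ (F n) t) :=
    ((ENNReal.measurable_ofReal.pow_const _).mul
      ((measurable_rearr μ (F n)).pow_const _)).const_mul κ
  rw [hint]
  calc ∫⁻ t in Ioo (0 : ℝ) 1, Φ t (rearr μ f t)
      ≤ ∫⁻ t in Ioo (0 : ℝ) 1, liminf (fun n => Φ t (rearr μ (F n) t)) atTop := by
        refine setLIntegral_mono' measurableSet_Ioo fun t ht => ?_
        exact (hΦmono t (rearr_le_liminf h)).trans_eq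
          ((hΦmono t).map_liminf_of_continuousAt _ (hΦcont ht.1).continuousAt)
    _ ≤ liminf (fun n => ∫⁻ t in Ioo (0 : ℝ) 1, Φ t (rearr μ (F n) t)) atTop :=
        lintegral_liminf_le hmeas
    _ ≤ δ ^ (q - ε) := by
        refine liminf_le_of_frequently_le' (Eventually.frequently ?_)
        filter_upwards [hδ] with n hn
        rw [← hint, ← ENNReal.rpow_inv_le_iff ha, ← one_div]
        exact (le_iSup₂ (f := fun ε (_ : ε ∈ Ioo (0 : ℝ) (q - 1)) =>
          (ENNReal.ofReal (q / p * ε) * ∫⁻ t in Ioo (0 : ℝ) 1,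
            ENNReal.ofReal t ^ (q / p - 1) * rearr μ (F n) t ^ (q - ε)) ^ (1 / (q - ε))) ε hε).trans
          hn

/-- A Cauchy sequence for the grand Lorentz functional has an almost everywhere convergent
subsequence. -/
lemma exists_subseq_tendsto_ae_of_cauchy (hq : 1 < q) (hqp : q < p) {F : ℕ → UnitIoo → ℝ}
    (hF : ∀ n, Measurable (F n))
    (hcauchy : ∀ δ : ℝ≥0∞, 0 < δ → ∃ N : ℕ, ∀ m ≥ N, ∀ n ≥ N,
      grandLorentzNorm μ p q (F m - F n) < δ) :
    ∃ (φ : ℕ → ℕ) (f : UnitIoo → ℝ), StrictMono φ ∧ Measurable f ∧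
      ∀ᵐ x ∂μ, Tendsto (fun k => F (φ k) x) atTop (nhds (f x)) := by
  have hmem (k : ℕ) : (1 / 2 : ℝ) ^ (k + 1) ∈ Ioo (0 : ℝ) 1 :=
    ⟨by positivity, pow_lt_one₀ (by norm_num) (by norm_num) k.succ_ne_zero⟩
  choose C hC0 hCtop hC using fun k => exists_mul_rearr_le_grandLorentzNorm hq hqp (hmem k)
  have hev (k : ℕ) : ∀ᶠ n in atTop, ∀ m ≥ n, grandLorentzNorm μ p q (F m - F n) ≤
      C k * ENNReal.ofReal ((1 / 2) ^ k) := by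
    have hpos : 0 < C k * ENNReal.ofReal ((1 / 2) ^ k) :=
      ENNReal.mul_pos (hC0 k) (by simp)
    obtain ⟨N, hN⟩ := hcauchy _ hpos
    filter_upwards [eventually_ge_atTop N] with n hn m hm
    exact (hN m (hn.trans hm) n hn).le
  obtain ⟨φ, hφ, hφle⟩ := extraction_forall_of_eventually hev
  have hmeas (k : ℕ) : μ {x | ENNReal.ofReal ((1 / 2) ^ k) <
      ENNReal.ofReal |(F (φ (k + 1)) - F (φ k)) x|} ≤ ENNReal.ofReal ((1 / 2) ^ (k + 1)) := by
    rw [← rearr_le_iff, ← ENNReal.mul_le_mul_iff_right (hC0 k) (hCtop k)]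
    exact (hC k _ _).trans (hφle k _ (hφ k.lt_succ_self).le)
  have hsum : ∑' k, μ {x | ENNReal.ofReal ((1 / 2) ^ k) <
      ENNReal.ofReal |(F (φ (k + 1)) - F (φ k)) x|} ≠ ⊤ := by
    refine ne_top_of_le_ne_top ?_ (ENNReal.tsum_le_tsum hmeas)
    rw [← ENNReal.ofReal_tsum_of_nonneg (fun k => (hmem k).1.le)
      ((summable_nat_add_iff 1).2 summable_geometric_two)]
    exact ofReal_ne_top
  have hconv : ∀ᵐ x ∂μ, ∃ l, Tendsto (fun k => F (φ k) x) atTop (nhds l) := by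
    filter_upwards [ae_eventually_notMem hsum] with x hx
    refine cauchySeq_tendsto_of_complete (cauchySeq_of_summable_dist
      (Summable.of_norm_bounded_eventually_nat summable_geometric_two ?_))
    filter_upwards [hx] with k hk
    have hk' : |F (φ (k + 1)) x - F (φ k) x| ≤ (1 / 2) ^ k :=
      (ENNReal.ofReal_le_ofReal_iff (by positivity)).1 (not_lt.1 hk)
    rwa [Real.norm_of_nonneg dist_nonneg, dist_comm, Real.dist_eq]
  obtain ⟨f, hf, hlim⟩ := measurable_limit_of_tendsto_metrizable_ae
    (fun k => (hF (φ k)).aemeasurable) hconv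
  exact ⟨φ, f, hφ, hf, hlim⟩

end GrandLorentz

/-- Let `1 < q < p < ∞`, `1 < s < r < ∞`, let `μ ≈ ν` be finite measures on `X = (0,1)`,
and suppose `L^{p,q)}(X,μ) ⊆ L^{r,s)}(X,ν)` in the sense of individual functions.  Then
`L^{p,q)}(X,μ)`, identified modulo `μ`-a.e. equality and endowed with the sum norm
`‖f‖ = ‖f‖_{p,q),μ} + ‖f‖_{r,s),ν}`, is a complete normed space: the sum functional is
subadditive, absolutely homogeneous, definite modulo `μ`-a.e. equality, and every Cauchy
sequence in it converges. -/
theorem stmt4 (p q r s : ℝ) (hq : 1 < q) (hqp : q < p) (hs : 1 < s) (hsr : s < r)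
    (μ ν : Measure UnitIoo) [IsFiniteMeasure μ] [IsFiniteMeasure ν]
    (hμν : μ ≪ ν ∧ ν ≪ μ)
    (hincl : ∀ f : UnitIoo → ℝ, Measurable f → grandLorentzNorm μ p q f < ∞ →
      grandLorentzNorm ν r s f < ∞) :
    (∀ f g : UnitIoo → ℝ, Measurable f → Measurable g →
        grandLorentzNorm μ p q f < ∞ → grandLorentzNorm μ p q g < ∞ →
        sumNorm μ ν p q r s (f + g) ≤ sumNorm μ ν p q r s f + sumNorm μ ν p q r s g) ∧
    (∀ (c : ℝ) (f : UnitIoo → ℝ), Measurable f → grandLorentzNorm μ p q f < ∞ →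
        sumNorm μ ν p q r s (c • f) = ENNReal.ofReal |c| * sumNorm μ ν p q r s f) ∧
    (∀ f : UnitIoo → ℝ, Measurable f → grandLorentzNorm μ p q f < ∞ →
        sumNorm μ ν p q r s f = 0 → f =ᵐ[μ] 0) ∧
    (∀ F : ℕ → UnitIoo → ℝ, (∀ n, Measurable (F n)) →
        (∀ n, grandLorentzNorm μ p q (F n) < ∞) →
        (∀ δ : ℝ≥0∞, 0 < δ → ∃ N : ℕ, ∀ m ≥ N, ∀ n ≥ N,
          sumNorm μ ν p q r s (F m - F n) < δ) →
        ∃ f : UnitIoo → ℝ, Measurable f ∧ grandLorentzNorm μ p q f < ∞ ∧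
          Tendsto (fun n => sumNorm μ ν p q r s (F n - f)) atTop (nhds 0)) := by
  refine ⟨fun f g hf hg _ _ => ?_, fun c f _ _ => ?_, fun f _ _ h => ?_,
    fun F hF hFfin hcauchy => ?_⟩
  · exact (add_le_add (grandLorentzNorm_add_le hq hqp hf hg)
      (grandLorentzNorm_add_le hs hsr hf hg)).trans_eq (add_add_add_comm _ _ _ _)
  · simp only [sumNorm, grandLorentzNorm_const_smul, mul_add]
  · exact ae_eq_zero_of_grandLorentzNorm_eq_zero hq hqp (add_eq_zero.1 h).1
  · obtain ⟨φ, f, hφ, hf, hlim⟩ := exists_subseq_tendsto_ae_of_cauchy hq hqp hF fun δ hδ => by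
      obtain ⟨N, hN⟩ := hcauchy δ hδ
      exact ⟨N, fun m hm n hn => le_self_add.trans_lt (hN m hm n hn)⟩
    have hbound {δ : ℝ≥0∞} (hδ : 0 < δ) : ∃ N, ∀ n ≥ N,
        grandLorentzNorm μ p q (F n - f) ≤ δ ∧ grandLorentzNorm ν r s (F n - f) ≤ δ := by
      obtain ⟨N, hN⟩ := hcauchy δ hδ
      refine ⟨N, fun n hn => ?_⟩
      have hdiff : ∀ᵐ x ∂μ,
          Tendsto (fun k => (F n - F (φ k)) x) atTop (nhds ((F n - f) x)) := by
        filter_upwards [hlim] with x hx using hx.const_sub (F n x)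
      have hsmall : ∀ᶠ k in atTop, sumNorm μ ν p q r s (F n - F (φ k)) ≤ δ := by
        filter_upwards [hφ.tendsto_atTop.eventually_ge_atTop N] with k hk
        exact (hN n hn _ hk).le
      exact ⟨grandLorentzNorm_le_of_tendsto_ae hdiff (hsmall.mono fun k => le_self_add.trans),
        grandLorentzNorm_le_of_tendsto_ae (hμν.2.ae_le hdiff)
          (hsmall.mono fun k => le_add_self.trans)⟩
    refine ⟨f, hf, ?_, ?_⟩
    · obtain ⟨N, hN⟩ := hbound one_pos
      have hdecomp : f = F N + (-1 : ℝ) • (F N - f) := by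
        ext x; simp
      rw [hdecomp]
      refine (grandLorentzNorm_add_le hq hqp (hF N)
        (((hF N).sub hf).const_smul (-1 : ℝ))).trans_lt (ENNReal.add_lt_top.2 ⟨hFfin N, ?_⟩)
      rw [grandLorentzNorm_const_smul]
      simpa using (hN N le_rfl).1.trans_lt one_lt_top
    · refine ENNReal.tendsto_nhds_zero.2 fun δ hδ => ?_
      obtain ⟨N, hN⟩ := hbound (ENNReal.half_pos hδ.ne')
      filter_upwards [eventually_ge_atTop N] with n hn
      exact (add_le_add (hN n hn).1 (hN n hn).2).trans_eq (ENNReal.add_halves δ)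
end

section
/- Let 1 < q ≤ p < r ≤ s < ∞ and let μ be a finite measure on (X,Σ) with X = (0,1). If L^{p,q)}(X,μ) ⊆ L^{r,s)}(X,μ) holds in the sense of equivalence classes, then there exists a constant M > 0 such that μ(A) ≥ M for every A ∈ Σ with μ(A) > 0. -/
open MeasureTheory Set ENNReal

/-- If every scale contains a set of positive measure below it, there is a sequence of such sets
whose measures at least halve at each step. -/
lemma exists_seq_measure_halving (μ : Measure UnitIoo)
    (h : ∀ δ : ℝ, 0 < δ → ∃ A : Set UnitIoo, MeasurableSet A ∧ 0 < μ.real A ∧ μ.real A < δ) :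
    ∃ A : ℕ → Set UnitIoo, (∀ n, MeasurableSet (A n)) ∧ (∀ n, 0 < μ.real (A n)) ∧
      μ.real (A 0) < 1 ∧ ∀ n, μ.real (A (n + 1)) ≤ μ.real (A n) / 2 := by
  choose! B hBm hB0 hBd using h
  let A : ℕ → Set UnitIoo := fun n => Nat.rec (B 1) (fun _ S => B (μ.real S / 2)) n
  have hsucc : ∀ n, A (n + 1) = B (μ.real (A n) / 2) := fun _ => rfl
  have hpos : ∀ n, 0 < μ.real (A n) := by
    intro n
    induction n with
    | zero => exact hB0 1 one_pos
    | succ n ih => rw [hsucc]; exact hB0 _ (half_pos ih)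
  refine ⟨A, fun n => ?_, hpos, hBd 1 one_pos, fun n => ?_⟩
  · cases n with
    | zero => exact hBm 1 one_pos
    | succ n => rw [hsucc]; exact hBm _ (half_pos (hpos n))
  · rw [hsucc]; exact (hBd _ (half_pos (hpos n))).le

lemma le_mul_half_pow {a : ℕ → ℝ} (h : ∀ n, a (n + 1) ≤ a n / 2) (N k : ℕ) :
    a (N + k) ≤ a N * (1 / 2) ^ k := by
  induction k with
  | zero => simp
  | succ k ih =>
    have := h (N + k)
    rw [pow_succ, ← add_assoc]
    linarith

/-- In a sequence of sets whose measures halve, the sets of measure below `t / 2` have a union of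
measure at most `t`. -/
lemma measure_iUnion_small_le (μ : Measure UnitIoo) [IsFiniteMeasure μ] {A : ℕ → Set UnitIoo}
    (hhalf : ∀ n, μ.real (A (n + 1)) ≤ μ.real (A n) / 2) (t : ℝ) :
    μ (⋃ n, ⋃ (_ : μ.real (A n) < t / 2), A n) ≤ ENNReal.ofReal t := by
  classical
  by_cases hex : ∃ n, μ.real (A n) < t / 2
  · have hN := Nat.find_spec hex
    set N := Nat.find hex with hNdef
    have hsub : (⋃ n, ⋃ (_ : μ.real (A n) < t / 2), A n) ⊆ ⋃ k, A (N + k) := by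
      refine iUnion₂_subset fun n hn => ?_
      obtain ⟨k, rfl⟩ := Nat.exists_eq_add_of_le (Nat.find_min' hex hn)
      exact subset_iUnion (fun k => A (N + k)) k
    have hs : HasSum (fun k : ℕ => μ.real (A N) * (1 / 2 : ℝ) ^ k) (μ.real (A N) * 2) :=
      hasSum_geometric_two.mul_left _
    calc μ (⋃ n, ⋃ (_ : μ.real (A n) < t / 2), A n)
        ≤ μ (⋃ k, A (N + k)) := measure_mono hsub
      _ ≤ ∑' k, μ (A (N + k)) := measure_iUnion_le _
      _ ≤ ∑' k, ENNReal.ofReal (μ.real (A N) * (1 / 2 : ℝ) ^ k) := by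
          refine ENNReal.tsum_le_tsum fun k => ?_
          rw [← ofReal_measureReal (measure_ne_top μ _)]
          exact ENNReal.ofReal_le_ofReal (le_mul_half_pow (a := fun n => μ.real (A n)) hhalf N k)
      _ = ENNReal.ofReal (μ.real (A N) * 2) := by
          rw [← ENNReal.ofReal_tsum_of_nonneg (fun k => by positivity) hs.summable, hs.tsum_eq]
      _ ≤ ENNReal.ofReal t := ENNReal.ofReal_le_ofReal (by linarith)
  · have : (⋃ n, ⋃ (_ : μ.real (A n) < t / 2), A n) = ∅ := by
      simp only [iUnion_eq_empty]
      exact fun n hn => absurd ⟨n, hn⟩ hex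
    simp [this]

/-- The function `sup_n μ(A n)^(-β) 1_{A n}`. -/
noncomputable def spike (μ : Measure UnitIoo) (A : ℕ → Set UnitIoo) (β : ℝ) (x : UnitIoo) :
    ℝ≥0∞ :=
  ⨆ n, (A n).indicator (fun _ => ENNReal.ofReal (μ.real (A n) ^ (-β))) x

lemma measurable_spike (μ : Measure UnitIoo) {A : ℕ → Set UnitIoo}
    (hA : ∀ n, MeasurableSet (A n)) (β : ℝ) : Measurable (spike μ A β) :=
  Measurable.iSup fun n => measurable_const.indicator (hA n)

lemma le_spike (μ : Measure UnitIoo) (A : ℕ → Set UnitIoo) (β : ℝ) {n : ℕ} {x : UnitIoo}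
    (hx : x ∈ A n) : ENNReal.ofReal (μ.real (A n) ^ (-β)) ≤ spike μ A β x :=
  le_iSup_of_le n (by simp [hx])

lemma measure_lt_spike_le (μ : Measure UnitIoo) [IsFiniteMeasure μ] {A : ℕ → Set UnitIoo}
    (hhalf : ∀ n, μ.real (A (n + 1)) ≤ μ.real (A n) / 2)
    {β : ℝ} (hβ : 0 < β) {t : ℝ} (ht : 0 < t) :
    μ {x | ENNReal.ofReal ((t / 2) ^ (-β)) < spike μ A β x} ≤ ENNReal.ofReal t := by
  refine (measure_mono fun x hx => ?_).trans (measure_iUnion_small_le μ hhalf t)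
  obtain ⟨n, hn⟩ := lt_iSup_iff.1 (show _ < spike μ A β x from hx)
  by_cases hxn : x ∈ A n
  · rw [indicator_of_mem hxn] at hn
    refine mem_iUnion₂.2 ⟨n, ?_, hxn⟩
    by_contra! hle
    refine absurd hn (not_lt.2 (ENNReal.ofReal_le_ofReal ?_))
    exact Real.rpow_le_rpow_of_nonpos (by positivity) hle (by linarith)
  · simp [indicator_of_notMem hxn] at hn

lemma ae_spike_lt_top (μ : Measure UnitIoo) [IsFiniteMeasure μ] {A : ℕ → Set UnitIoo}
    (hhalf : ∀ n, μ.real (A (n + 1)) ≤ μ.real (A n) / 2)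
    {β : ℝ} (hβ : 0 < β) : ∀ᵐ x ∂μ, spike μ A β x < ∞ := by
  rw [ae_iff]
  refine le_antisymm (ENNReal.le_of_forall_pos_le_add fun t ht0 _ => ?_) zero_le
  rw [zero_add]
  have ht : (0 : ℝ) < t := ht0
  calc μ {x | ¬ spike μ A β x < ∞}
      ≤ μ {x | ENNReal.ofReal (((t : ℝ) / 2) ^ (-β)) < spike μ A β x} := by
        refine measure_mono fun x hx => ?_
        simp only [mem_ofPred_eq, not_lt, top_le_iff] at hx ⊢
        rw [hx]; exact ENNReal.ofReal_lt_top
    _ ≤ ENNReal.ofReal t := measure_lt_spike_le μ hhalf hβ ht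
    _ = t := ENNReal.ofReal_coe_nnreal

lemma ofReal_abs_toReal_le (z : ℝ≥0∞) : ENNReal.ofReal |z.toReal| ≤ z := by
  rw [abs_of_nonneg ENNReal.toReal_nonneg]; exact ENNReal.ofReal_toReal_le

lemma rearr_spike_le (μ : Measure UnitIoo) [IsFiniteMeasure μ] {A : ℕ → Set UnitIoo}
    (hhalf : ∀ n, μ.real (A (n + 1)) ≤ μ.real (A n) / 2)
    {β : ℝ} (hβ : 0 < β) {t : ℝ} (ht : 0 < t) :
    rearr μ (fun x => (spike μ A β x).toReal) t ≤ ENNReal.ofReal ((t / 2) ^ (-β)) := by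
  refine sInf_le ⟨by simp only [ENNReal.ofReal_pos]; positivity, ?_⟩
  refine (measure_mono fun x hx => ?_).trans (measure_lt_spike_le μ hhalf hβ ht)
  exact lt_of_lt_of_le hx (ofReal_abs_toReal_le _)

lemma le_rearr_spike (μ : Measure UnitIoo) [IsFiniteMeasure μ] {A : ℕ → Set UnitIoo}
    (hpos : ∀ n, 0 < μ.real (A n)) (hhalf : ∀ n, μ.real (A (n + 1)) ≤ μ.real (A n) / 2)
    {β : ℝ} (hβ : 0 < β) {n : ℕ} {t : ℝ} (ht : t < μ.real (A n)) :
    ENNReal.ofReal (μ.real (A n) ^ (-β)) ≤ rearr μ (fun x => (spike μ A β x).toReal) t := by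
  refine le_sInf fun y hy => ?_
  by_contra! hlt
  have hle : μ (A n) ≤ ENNReal.ofReal t := by
    refine (measure_mono_ae ?_).trans hy.2
    filter_upwards [ae_spike_lt_top μ hhalf hβ] with x hx hxA
    change y < ENNReal.ofReal |(spike μ A β x).toReal|
    rw [abs_of_nonneg ENNReal.toReal_nonneg, ENNReal.ofReal_toReal hx.ne]
    exact hlt.trans_le (le_spike μ A β hxA)
  rw [← ofReal_measureReal (measure_ne_top μ _)] at hle
  exact absurd hle (not_le.2 ((ENNReal.ofReal_lt_ofReal_iff (hpos n)).2 ht))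

/-- A function whose rearrangement is `O(t^(-β))` with `β < 1 / p` has finite grand Lorentz
functional. -/
lemma grandLorentzNorm_lt_top_of_rearr_le {μ : Measure UnitIoo} {p q β : ℝ} (hq : 1 < q)
    (hp : 0 < p) (hβ : 0 < β) (hβp : β < 1 / p) {f : UnitIoo → ℝ}
    (h : ∀ t : ℝ, 0 < t → rearr μ f t ≤ ENNReal.ofReal ((t / 2) ^ (-β))) :
    grandLorentzNorm μ p q f < ∞ := by
  set K : ℝ≥0∞ := ∫⁻ t in Ioo (0 : ℝ) 1,
    ENNReal.ofReal (t ^ (q / p - 1 - β * q) * (2 : ℝ) ^ (β * q)) with hK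
  have hKtop : K < ∞ := by
    have hexp : -1 < q / p - 1 - β * q := by
      have : β * q < 1 / p * q := mul_lt_mul_of_pos_right hβp (by linarith)
      rw [one_div_mul_eq_div] at this
      linarith
    have hi := ((intervalIntegral.integrableOn_Ioo_rpow_iff one_pos).2 hexp).mul_const
      ((2 : ℝ) ^ (β * q))
    exact hi.lintegral_lt_top
  have hM : max 1 (ENNReal.ofReal (q / p * (q - 1)) * K) < ∞ :=
    max_lt ENNReal.one_lt_top (ENNReal.mul_lt_top ENNReal.ofReal_lt_top hKtop)
  refine lt_of_le_of_lt (iSup₂_le fun ε hε => ?_) hM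
  have hqε : 1 < q - ε := by linarith [hε.2]
  have hint : ∫⁻ t in Ioo (0 : ℝ) 1,
      ENNReal.ofReal t ^ (q / p - 1) * rearr μ f t ^ (q - ε) ≤ K := by
    refine setLIntegral_mono' measurableSet_Ioo fun t ht => ?_
    have ht0 : 0 < t := ht.1
    calc ENNReal.ofReal t ^ (q / p - 1) * rearr μ f t ^ (q - ε)
        ≤ ENNReal.ofReal t ^ (q / p - 1) * ENNReal.ofReal ((t / 2) ^ (-β)) ^ (q - ε) := by
          gcongr
          exact h t ht0
      _ = ENNReal.ofReal (t ^ (q / p - 1) * (t / 2) ^ (-β * (q - ε))) := by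
          rw [ENNReal.ofReal_rpow_of_pos ht0, ENNReal.ofReal_rpow_of_pos (by positivity),
            ← ENNReal.ofReal_mul (by positivity), ← Real.rpow_mul (by positivity)]
      _ ≤ ENNReal.ofReal (t ^ (q / p - 1) * (t / 2) ^ (-(β * q))) := by
          apply ENNReal.ofReal_le_ofReal
          refine mul_le_mul_of_nonneg_left ?_ (by positivity)
          refine Real.rpow_le_rpow_of_exponent_ge (by positivity) (by linarith [ht.2]) ?_
          nlinarith [mul_pos hβ hε.1]
      _ = ENNReal.ofReal (t ^ (q / p - 1 - β * q) * (2 : ℝ) ^ (β * q)) := by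
          rw [Real.div_rpow ht0.le (by norm_num), Real.rpow_neg (by norm_num : (0 : ℝ) ≤ 2),
            div_inv_eq_mul, ← mul_assoc, ← Real.rpow_add ht0, sub_eq_add_neg (q / p - 1)]
  calc (ENNReal.ofReal (q / p * ε) * ∫⁻ t in Ioo (0 : ℝ) 1,
          ENNReal.ofReal t ^ (q / p - 1) * rearr μ f t ^ (q - ε)) ^ (1 / (q - ε))
      ≤ (max 1 (ENNReal.ofReal (q / p * (q - 1)) * K)) ^ (1 / (q - ε)) := by
        refine ENNReal.rpow_le_rpow (le_max_of_le_right ?_) (by positivity)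
        refine mul_le_mul' (ENNReal.ofReal_le_ofReal ?_) hint
        exact mul_le_mul_of_nonneg_left hε.2.le (by positivity)
    _ ≤ (max 1 (ENNReal.ofReal (q / p * (q - 1)) * K)) ^ (1 : ℝ) := by
        refine ENNReal.rpow_le_rpow_of_exponent_le (le_max_left _ _) ?_
        rw [div_le_one (by linarith)]; exact hqε.le
    _ = _ := ENNReal.rpow_one _

/-- If the rearrangement is at least `a^(-β)` on `(0, a)` for arbitrarily small `a`, with
`1 / r < β`, the grand Lorentz functional is infinite. -/
lemma grandLorentzNorm_eq_top_of_le_rearr {μ : Measure UnitIoo} {r s β : ℝ} (hr : 0 < r)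
    (hs : 1 < s) (hrs : r ≤ s) (hβ : 1 / r < β) {f : UnitIoo → ℝ} {a : ℕ → ℝ}
    (ha0 : ∀ n, 0 < a n) (ha1 : ∀ n, a n ≤ 1) (ha : Filter.Tendsto a Filter.atTop (nhds 0))
    (h : ∀ n t, t < a n → ENNReal.ofReal (a n ^ (-β)) ≤ rearr μ f t) :
    grandLorentzNorm μ r s f = ∞ := by
  have hβ0 : 0 < β := lt_trans (by positivity) hβ
  obtain ⟨ε, hε, hθ⟩ : ∃ ε ∈ Ioo (0 : ℝ) (s - 1), 0 < β * (s - ε) - s / r := by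
    have hgap : 0 < β * s - s / r := by
      have : 1 / r * s < β * s := mul_lt_mul_of_pos_right hβ (by linarith)
      rw [one_div_mul_eq_div] at this
      linarith
    have hm : 0 < min ((s - 1) / 2) ((β * s - s / r) / (2 * β)) :=
      lt_min (by linarith) (by positivity)
    refine ⟨_, ⟨hm, (min_le_left _ _).trans_lt (by linarith)⟩, ?_⟩
    have := mul_le_mul_of_nonneg_left
      (min_le_right ((s - 1) / 2) ((β * s - s / r) / (2 * β))) hβ0.le
    have h2 : β * ((β * s - s / r) / (2 * β)) = (β * s - s / r) / 2 := by field_simp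
    rw [h2] at this
    rw [mul_sub]
    linarith
  have hsε : 1 < s - ε := by linarith [hε.2]
  set θ := β * (s - ε) - s / r with hθdef
  set I := ∫⁻ t in Ioo (0 : ℝ) 1,
    ENNReal.ofReal t ^ (s / r - 1) * rearr μ f t ^ (s - ε) with hI
  have hsr : 0 ≤ s / r - 1 := by
    rw [sub_nonneg, one_le_div hr]; exact hrs
  have hlow : ∀ n, ENNReal.ofReal ((1 / 2 : ℝ) ^ (s / r) * a n ^ (-θ)) ≤ I := by
    intro n
    have hn := ha0 n
    calc ENNReal.ofReal ((1 / 2 : ℝ) ^ (s / r) * a n ^ (-θ))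
        = ENNReal.ofReal ((a n / 2) ^ (s / r - 1) * a n ^ (-β * (s - ε)))
            * volume (Ioo (a n / 2) (a n)) := by
          rw [Real.volume_Ioo, ← ENNReal.ofReal_mul (by positivity)]
          congr 1
          have e1 : a n - a n / 2 = a n / 2 := by ring
          have e2 : (a n / 2) ^ (s / r) = (a n / 2) ^ (s / r - 1) * (a n / 2) := by
            rw [← Real.rpow_add_one (by positivity)]; congr 1; ring
          have e3 : a n ^ (-θ) = a n ^ (s / r) * a n ^ (-β * (s - ε)) := by
            rw [← Real.rpow_add hn]; congr 1; rw [hθdef]; ring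
          rw [e1, e3, ← mul_assoc, ← Real.mul_rpow (by positivity) hn.le,
            show 1 / 2 * a n = a n / 2 by ring, e2]
          ring
      _ = ∫⁻ _ in Ioo (a n / 2) (a n),
            ENNReal.ofReal ((a n / 2) ^ (s / r - 1) * a n ^ (-β * (s - ε))) := by
          rw [setLIntegral_const]
      _ ≤ ∫⁻ t in Ioo (a n / 2) (a n),
            ENNReal.ofReal t ^ (s / r - 1) * rearr μ f t ^ (s - ε) := by
          refine setLIntegral_mono' measurableSet_Ioo fun t ht => ?_
          rw [ENNReal.ofReal_mul (by positivity), Real.rpow_mul hn.le,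
            ← ENNReal.ofReal_rpow_of_pos (by positivity),
            ← ENNReal.ofReal_rpow_of_pos (by positivity)]
          refine mul_le_mul' (ENNReal.rpow_le_rpow (ENNReal.ofReal_le_ofReal ht.1.le) hsr)
            (ENNReal.rpow_le_rpow (h n t ht.2) (by linarith))
      _ ≤ I := lintegral_mono_set (Ioo_subset_Ioo (by positivity) (ha1 n))
  have hItop : I = ∞ := by
    have ha' : Filter.Tendsto a Filter.atTop (nhdsWithin 0 (Ioi 0)) :=
      tendsto_nhdsWithin_iff.2 ⟨ha, Filter.Eventually.of_forall ha0⟩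
    have hdiv : Filter.Tendsto (fun n => (1 / 2 : ℝ) ^ (s / r) * a n ^ (-θ))
        Filter.atTop Filter.atTop :=
      ((tendsto_rpow_neg_nhdsGT_zero (by linarith)).comp ha').const_mul_atTop (by positivity)
    exact top_le_iff.1 (le_of_tendsto' (ENNReal.tendsto_ofReal_atTop.comp hdiv) hlow)
  refine top_le_iff.1 (le_trans (le_of_eq ?_) (le_iSup₂
    (f := fun ε (_ : ε ∈ Ioo (0 : ℝ) (s - 1)) =>
    (ENNReal.ofReal (s / r * ε) * ∫⁻ t in Ioo (0 : ℝ) 1,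
      ENNReal.ofReal t ^ (s / r - 1) * rearr μ f t ^ (s - ε)) ^ (1 / (s - ε))) ε hε))
  have hε0 := hε.1
  have hc : ENNReal.ofReal (s / r * ε) ≠ 0 := by
    rw [← pos_iff_ne_zero, ENNReal.ofReal_pos]; positivity
  change ∞ = (ENNReal.ofReal (s / r * ε) * I) ^ (1 / (s - ε))
  rw [hItop, ENNReal.mul_top hc, ENNReal.top_rpow_of_pos (by positivity)]

/-- Let `1 < q ≤ p < r ≤ s < ∞` and let `μ` be a finite measure on `X = (0,1)`.  If
`L^{p,q)}(X,μ) ⊆ L^{r,s)}(X,μ)` in the sense of equivalence classes, then there is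
`M > 0` such that `μ(A) ≥ M` for every `μ`-non-null `A ∈ Σ`. -/
theorem stmt7 (p q r s : ℝ) (hq : 1 < q) (hqp : q ≤ p) (hpr : p < r) (hrs : r ≤ s)
    (μ : Measure UnitIoo) [IsFiniteMeasure μ]
    (hincl : ∀ f : UnitIoo → ℝ, Measurable f → grandLorentzNorm μ p q f < ∞ →
      ∀ g : UnitIoo → ℝ, Measurable g → f =ᵐ[μ] g → grandLorentzNorm μ r s g < ∞) :
    ∃ M : ℝ, 0 < M ∧
      ∀ A : Set UnitIoo, MeasurableSet A → 0 < μ A → ENNReal.ofReal M ≤ μ A := by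
  by_contra! hcon
  obtain ⟨A, hAm, hpos, hA0, hhalf⟩ := exists_seq_measure_halving μ fun δ hδ => by
    obtain ⟨A, hA, h0, hlt⟩ := hcon δ hδ
    exact ⟨A, hA, ENNReal.toReal_pos h0.ne' (measure_ne_top μ A),
      (ENNReal.lt_ofReal_iff_toReal_lt (measure_ne_top μ A)).1 hlt⟩
  have hp : 0 < p := by linarith
  obtain ⟨β, hβr, hβp⟩ := exists_between (one_div_lt_one_div_of_lt hp hpr)
  have hr : 0 < r := hp.trans hpr
  have hβ : 0 < β := lt_trans (by positivity) hβr
  have hpow : ∀ n, μ.real (A n) ≤ (1 / 2 : ℝ) ^ n := fun n => by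
    have := le_mul_half_pow (a := fun n => μ.real (A n)) hhalf 0 n
    rw [zero_add] at this
    exact this.trans (mul_le_of_le_one_left (by positivity) hA0.le)
  have hf : Measurable fun x => (spike μ A β x).toReal := (measurable_spike μ hAm β).ennreal_toReal
  refine (hincl _ hf (grandLorentzNorm_lt_top_of_rearr_le hq hp hβ hβp fun t ht =>
    rearr_spike_le μ hhalf hβ ht) _ hf Filter.EventuallyEq.rfl).ne ?_
  exact grandLorentzNorm_eq_top_of_le_rearr hr (by linarith) hrs hβr hpos
    (fun n => (hpow n).trans (pow_le_one₀ (by norm_num) (by norm_num)))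
    (squeeze_zero (fun n => (hpos n).le) hpow
      (tendsto_pow_atTop_nhds_zero_of_lt_one (by norm_num) (by norm_num)))
    fun n t ht => le_rearr_spike μ hpos hhalf hβ ht
end
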